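/- arXiv:1710.00427 — 2 statements merged into one kernel-verified Lean document; each statement's English description precedes it below -/
import Mathlib

section
/- For any two unital quantum channels E₁ : M_d → M_d and E₂ : M_{d'} → M_{d'}, the stabilized multiplicative domain of their tensor product splits: M_{(E₁⊗E₂)^∞} = M_{E₁^∞} ⊗ M_{E₂^∞}. -/
open scoped Kronecker ComplexOrder

noncomputable section

/-- The amplification `1_n ⊗ E` of a linear map on matrices, acting on `M_n ⊗ M_ι`. -/
def ampl {ι : Type*} [Fintype ι] (n : ℕ)
    (E : Module.End ℂ (Matrix ι ι ℂ))
    (A : Matrix (Fin n × ι) (Fin n × ι) ℂ) :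
    Matrix (Fin n × ι) (Fin n × ι) ℂ :=
  Matrix.of fun p q => E (Matrix.of fun a b => A (p.1, a) (q.1, b)) p.2 q.2

/-- A quantum channel: completely positive (every amplification preserves positive
semidefiniteness) and trace preserving. -/
def IsQuantumChannel {ι : Type*} [Fintype ι] (E : Module.End ℂ (Matrix ι ι ℂ)) : Prop :=
  (∀ (n : ℕ) (A : Matrix (Fin n × ι) (Fin n × ι) ℂ),
      A.PosSemidef → (ampl n E A).PosSemidef) ∧
    ∀ x : Matrix ι ι ℂ, (E x).trace = x.trace

/-- The multiplicative domain of a linear map on a matrix algebra. -/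
def multDomain {ι : Type*} [Fintype ι] (E : Module.End ℂ (Matrix ι ι ℂ)) :
    Set (Matrix ι ι ℂ) :=
  {x | ∀ y, E (x * y) = E x * E y ∧ E (y * x) = E y * E x}

/-- The multiplicative index: the least `n ≥ 1` from which the chain of multiplicative
domains of the powers of `E` has stabilized. -/
def multIndex {ι : Type*} [Fintype ι] (E : Module.End ℂ (Matrix ι ι ℂ)) : ℕ :=
  sInf {n | 0 < n ∧ ∀ m, n ≤ m → multDomain (E ^ m) = multDomain (E ^ n)}

/-- The stabilized multiplicative domain `M_{E^∞}`. -/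
def stabMultDomain {ι : Type*} [Fintype ι] (E : Module.End ℂ (Matrix ι ι ℂ)) :
    Set (Matrix ι ι ℂ) :=
  ⋂ (n : ℕ) (_ : 0 < n), multDomain (E ^ n)

open Matrix

set_option linter.unusedSectionVars false

variable {ι κ : Type*} [Fintype ι] [Fintype κ]

section Channel

/-- The squared Hilbert–Schmidt norm of a matrix. -/
def hsNormSq (x : Matrix ι ι ℂ) : ℝ := ∑ i, ∑ j, ‖x i j‖ ^ 2

lemma hsNormSq_conjTranspose (x : Matrix ι ι ℂ) : hsNormSq xᴴ = hsNormSq x := by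
  unfold hsNormSq
  rw [Finset.sum_comm]
  simp

lemma trace_conjTranspose_mul_self_eq_hsNormSq (x : Matrix ι ι ℂ) :
    (xᴴ * x).trace = (hsNormSq x : ℂ) := by
  unfold hsNormSq
  rw [Finset.sum_comm]
  simp [Matrix.trace, Matrix.mul_apply, Complex.conj_mul']

variable [DecidableEq ι] {E : Module.End ℂ (Matrix ι ι ℂ)}

lemma isQuantumChannel_pow (h : IsQuantumChannel E) (n : ℕ) : IsQuantumChannel (E ^ n) := by
  induction n with
  | zero => exact ⟨fun n A hA => hA, fun x => rfl⟩
  | succ n ih =>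
    rw [pow_succ']
    exact ⟨fun m A hA => h.1 m _ (ih.1 m A hA), fun x => (h.2 _).trans (ih.2 x)⟩

lemma pow_apply_one (hu : E 1 = 1) (n : ℕ) : (E ^ n) 1 = 1 := by
  induction n with
  | zero => rfl
  | succ n ih => rw [pow_succ', Module.End.mul_apply, ih, hu]

/-- A channel sends Gram matrices of matrix tuples to positive semidefinite block matrices. -/
lemma IsQuantumChannel.posSemidef_gram (h : IsQuantumChannel E) {n : ℕ}
    (f : Fin n → Matrix ι ι ℂ) :
    (Matrix.of fun p q : Fin n × ι => E ((f p.1)ᴴ * f q.1) p.2 q.2).PosSemidef :=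
  h.1 n _ (Matrix.posSemidef_conjTranspose_mul_self
    (Matrix.of fun (i : ι) (p : Fin n × ι) => f p.1 i p.2))

lemma IsQuantumChannel.map_conjTranspose (h : IsQuantumChannel E) (x : Matrix ι ι ℂ) :
    E xᴴ = (E x)ᴴ := by
  have key := (h.posSemidef_gram ![x, 1]).isHermitian
  ext a b
  have := congrFun (congrFun key (0, a)) (1, b)
  simpa using this.symm

/-- The defect vector on which the Gram block matrix of `(x, y, 1)` computes the
Kadison–Schwarz defect of `x`. -/
def defectVec (E : Module.End ℂ (Matrix ι ι ℂ)) (x : Matrix ι ι ℂ) (v : ι → ℂ) :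
    Fin 3 × ι → ℂ :=
  fun p => (![v, 0, -(E x *ᵥ v)] : Fin 3 → ι → ℂ) p.1 p.2

lemma gram_mulVec_defectVec (E : Module.End ℂ (Matrix ι ι ℂ)) (x : Matrix ι ι ℂ)
    (f : Fin 3 → Matrix ι ι ℂ) (hf0 : f 0 = x) (hf2 : f 2 = 1) (v : ι → ℂ) (p : Fin 3 × ι) :
    ((Matrix.of fun p q : Fin 3 × ι => E ((f p.1)ᴴ * f q.1) p.2 q.2) *ᵥ defectVec E x v) p =
      ((E ((f p.1)ᴴ * x) - E (f p.1)ᴴ * E x) *ᵥ v) p.2 := by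
  rw [Matrix.sub_mulVec, ← Matrix.mulVec_mulVec, Pi.sub_apply]
  simp only [Matrix.mulVec, dotProduct, Fintype.sum_prod_type, Fin.sum_univ_three, defectVec,
    Matrix.of_apply, hf0, hf2]
  simp [Matrix.mulVec, dotProduct, sub_eq_add_neg]

lemma star_defectVec_dotProduct_gram (h : IsQuantumChannel E) (hu : E 1 = 1)
    (x y : Matrix ι ι ℂ) (v : ι → ℂ) :
    star (defectVec E x v) ⬝ᵥ
      ((Matrix.of fun p q : Fin 3 × ι =>
        E ((![x, y, 1] p.1)ᴴ * ![x, y, 1] q.1) p.2 q.2) *ᵥ defectVec E x v) =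
      star v ⬝ᵥ ((E (xᴴ * x) - (E x)ᴴ * E x) *ᵥ v) := by
  have key := gram_mulVec_defectVec E x ![x, y, 1] rfl rfl v
  rw [funext key]
  simp [dotProduct, Fintype.sum_prod_type, Fin.sum_univ_three, defectVec, hu,
    h.map_conjTranspose]

/-- The Kadison–Schwarz inequality. -/
lemma IsQuantumChannel.posSemidef_defect (h : IsQuantumChannel E) (hu : E 1 = 1)
    (x : Matrix ι ι ℂ) : (E (xᴴ * x) - (E x)ᴴ * E x).PosSemidef := by
  refine Matrix.PosSemidef.of_dotProduct_mulVec_nonneg ?_ fun v => ?_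
  · refine Matrix.IsHermitian.sub ?_ (Matrix.isHermitian_conjTranspose_mul_self _)
    rw [Matrix.IsHermitian, ← h.map_conjTranspose]
    simp
  · rw [← star_defectVec_dotProduct_gram h hu x 0]
    exact (h.posSemidef_gram ![x, 0, 1]).dotProduct_mulVec_nonneg _

/-- Choi's theorem on multiplicative domains. -/
lemma IsQuantumChannel.map_mul_of_defect_eq_zero (h : IsQuantumChannel E) (hu : E 1 = 1)
    {x : Matrix ι ι ℂ} (hx : E (xᴴ * x) - (E x)ᴴ * E x = 0) (y : Matrix ι ι ℂ) :
    E (y * x) = E y * E x := by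
  rw [← sub_eq_zero]
  refine Matrix.mulVec_injective (funext fun v => funext fun a => ?_)
  have h0 := star_defectVec_dotProduct_gram h hu x yᴴ v
  rw [hx, Matrix.zero_mulVec, dotProduct_zero,
    (h.posSemidef_gram ![x, yᴴ, 1]).dotProduct_mulVec_zero_iff] at h0
  have h1 := gram_mulVec_defectVec E x ![x, yᴴ, 1] rfl rfl v (1, a)
  rw [h0] at h1
  simpa using h1.symm

lemma IsQuantumChannel.trace_defect (h : IsQuantumChannel E) (x : Matrix ι ι ℂ) :
    (E (xᴴ * x) - (E x)ᴴ * E x).trace = ((hsNormSq x - hsNormSq (E x) : ℝ) : ℂ) := by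
  rw [Matrix.trace_sub, h.2, trace_conjTranspose_mul_self_eq_hsNormSq,
    trace_conjTranspose_mul_self_eq_hsNormSq]
  push_cast
  rfl

lemma IsQuantumChannel.hsNormSq_le (h : IsQuantumChannel E) (hu : E 1 = 1) (x : Matrix ι ι ℂ) :
    hsNormSq (E x) ≤ hsNormSq x := by
  have := (h.posSemidef_defect hu x).trace_nonneg
  rw [h.trace_defect, Complex.zero_le_real] at this
  linarith

lemma IsQuantumChannel.map_mul_of_hsNormSq_eq (h : IsQuantumChannel E) (hu : E 1 = 1)
    {x : Matrix ι ι ℂ} (hx : hsNormSq (E x) = hsNormSq x) (y : Matrix ι ι ℂ) :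
    E (y * x) = E y * E x := by
  refine h.map_mul_of_defect_eq_zero hu ?_ y
  rw [← (h.posSemidef_defect hu x).trace_eq_zero_iff, h.trace_defect, hx]
  simp

/-- For a unital channel, isometric elements lie in the multiplicative domain. -/
lemma IsQuantumChannel.mem_multDomain_of_hsNormSq_eq (h : IsQuantumChannel E) (hu : E 1 = 1)
    {x : Matrix ι ι ℂ} (hx : hsNormSq (E x) = hsNormSq x) : x ∈ multDomain E := by
  refine fun y => ⟨?_, h.map_mul_of_hsNormSq_eq hu hx y⟩
  have hx' : hsNormSq (E xᴴ) = hsNormSq xᴴ := by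
    rw [h.map_conjTranspose, hsNormSq_conjTranspose, hsNormSq_conjTranspose, hx]
  have := congrArg conjTranspose (h.map_mul_of_hsNormSq_eq hu hx' yᴴ)
  rw [← Matrix.conjTranspose_mul, h.map_conjTranspose] at this
  simpa [h.map_conjTranspose] using this

end Channel

/-- The multiplicative domain as a subspace. -/
def multDomainSubmodule (E : Module.End ℂ (Matrix ι ι ℂ)) : Submodule ℂ (Matrix ι ι ℂ) where
  carrier := multDomain E
  add_mem' {a b} ha hb y := by simp [add_mul, mul_add, ha y, hb y]
  zero_mem' y := by simp
  smul_mem' c a ha y := by simp [ha y]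

/-- The stabilized multiplicative domain as a subspace. -/
def stabMultDomainSubmodule [DecidableEq ι] (E : Module.End ℂ (Matrix ι ι ℂ)) :
    Submodule ℂ (Matrix ι ι ℂ) :=
  ⨅ (n : ℕ) (_ : 0 < n), multDomainSubmodule (E ^ n)

lemma coe_stabMultDomainSubmodule [DecidableEq ι] (E : Module.End ℂ (Matrix ι ι ℂ)) :
    (stabMultDomainSubmodule E : Set (Matrix ι ι ℂ)) = stabMultDomain E := by
  simp only [stabMultDomainSubmodule, stabMultDomain, Submodule.coe_iInf]
  rfl

section Slices

/-- The slice of a bipartite matrix in the second factor. -/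
def rslice (i j : ι) : Matrix (ι × κ) (ι × κ) ℂ →ₗ[ℂ] Matrix κ κ ℂ where
  toFun x := Matrix.of fun a b => x (i, a) (j, b)
  map_add' _ _ := rfl
  map_smul' _ _ := rfl

/-- The slice of a bipartite matrix in the first factor. -/
def lslice (a b : κ) : Matrix (ι × κ) (ι × κ) ℂ →ₗ[ℂ] Matrix ι ι ℂ where
  toFun x := Matrix.of fun i j => x (i, a) (j, b)
  map_add' _ _ := rfl
  map_smul' _ _ := rfl

/-- The map `1 ⊗ G`. -/
def rampl (G : Module.End ℂ (Matrix κ κ ℂ)) : Module.End ℂ (Matrix (ι × κ) (ι × κ) ℂ) where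
  toFun x := Matrix.of fun p q => G (rslice p.1 q.1 x) p.2 q.2
  map_add' x y := by ext; simp
  map_smul' c x := by ext; simp

/-- The map `G ⊗ 1`. -/
def lampl (G : Module.End ℂ (Matrix ι ι ℂ)) : Module.End ℂ (Matrix (ι × κ) (ι × κ) ℂ) where
  toFun x := Matrix.of fun p q => G (lslice p.2 q.2 x) p.1 q.1
  map_add' x y := by ext; simp
  map_smul' c x := by ext; simp

lemma rampl_kronecker (G : Module.End ℂ (Matrix κ κ ℂ)) (x : Matrix ι ι ℂ) (y : Matrix κ κ ℂ) :
    rampl G (x ⊗ₖ y) = x ⊗ₖ G y := by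
  ext p q
  have : rslice p.1 q.1 (x ⊗ₖ y) = x p.1 q.1 • y := rfl
  simp [rampl, this]

lemma lampl_kronecker (G : Module.End ℂ (Matrix ι ι ℂ)) (x : Matrix ι ι ℂ) (y : Matrix κ κ ℂ) :
    lampl G (x ⊗ₖ y) = G x ⊗ₖ y := by
  ext p q
  have : lslice p.2 q.2 (x ⊗ₖ y) = y p.2 q.2 • x := by
    ext i j
    exact mul_comm _ _
  simp [lampl, this, mul_comm]

lemma hsNormSq_eq_sum_rslice (x : Matrix (ι × κ) (ι × κ) ℂ) :
    hsNormSq x = ∑ i, ∑ j, hsNormSq (rslice i j x) := by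
  simp only [hsNormSq, Fintype.sum_prod_type]
  exact Finset.sum_congr rfl fun i _ => Finset.sum_comm

lemma hsNormSq_eq_sum_lslice (x : Matrix (ι × κ) (ι × κ) ℂ) :
    hsNormSq x = ∑ a, ∑ b, hsNormSq (lslice a b x) := by
  simp only [hsNormSq, Fintype.sum_prod_type_right]
  exact Finset.sum_congr rfl fun i _ => Finset.sum_comm

lemma hsNormSq_rampl (G : Module.End ℂ (Matrix κ κ ℂ)) (x : Matrix (ι × κ) (ι × κ) ℂ) :
    hsNormSq (rampl G x) = ∑ i, ∑ j, hsNormSq (G (rslice i j x)) :=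
  hsNormSq_eq_sum_rslice _

lemma hsNormSq_lampl (G : Module.End ℂ (Matrix ι ι ℂ)) (x : Matrix (ι × κ) (ι × κ) ℂ) :
    hsNormSq (lampl G x) = ∑ a, ∑ b, hsNormSq (G (lslice a b x)) :=
  hsNormSq_eq_sum_lslice _

lemma sum_sum_eq_imp {α : Type*} [Fintype α] {f g : α → α → ℝ} (hle : ∀ a b, f a b ≤ g a b)
    (h : ∑ a, ∑ b, g a b ≤ ∑ a, ∑ b, f a b) (a b : α) : f a b = g a b := by
  have h1 : ∑ a, ∑ b, f a b = ∑ a, ∑ b, g a b :=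
    le_antisymm (Finset.sum_le_sum fun a _ => Finset.sum_le_sum fun b _ => hle a b) h
  rw [Finset.sum_eq_sum_iff_of_le
    fun a _ => Finset.sum_le_sum fun b _ => hle a b] at h1
  exact (Finset.sum_eq_sum_iff_of_le fun b _ => hle a b).1 (h1 a (Finset.mem_univ a)) b
    (Finset.mem_univ b)

variable [DecidableEq ι]

lemma eq_sum_single_kronecker_rslice (x : Matrix (ι × κ) (ι × κ) ℂ) :
    x = ∑ i, ∑ j, Matrix.single i j (1 : ℂ) ⊗ₖ rslice i j x := by
  ext p q
  simp [Matrix.sum_apply, Matrix.single_apply, rslice, ite_and]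
  rfl

lemma kronecker_induction {P : Matrix (ι × κ) (ι × κ) ℂ → Prop}
    (hadd : ∀ x y, P x → P y → P (x + y)) (hkr : ∀ x y, P (x ⊗ₖ y))
    (x : Matrix (ι × κ) (ι × κ) ℂ) : P x := by
  have h0 : P 0 := by simpa using hkr 0 0
  rw [eq_sum_single_kronecker_rslice x]
  exact Finset.sum_induction _ P hadd h0 fun i _ =>
    Finset.sum_induction _ P hadd h0 fun j _ => hkr _ _

/-- A bipartite matrix whose slices lie in `V` and `W` belongs to `V ⊗ W`. -/
lemma mem_span_kronecker_of_slices {V : Submodule ℂ (Matrix ι ι ℂ)}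
    {W : Submodule ℂ (Matrix κ κ ℂ)} {x : Matrix (ι × κ) (ι × κ) ℂ}
    (hV : ∀ a b, lslice a b x ∈ V) (hW : ∀ i j, rslice i j x ∈ W) :
    x ∈ Submodule.span ℂ {z | ∃ a ∈ V, ∃ b ∈ W, z = a ⊗ₖ b} := by
  obtain ⟨P, hP⟩ := V.exists_isCompl
  let p : Module.End ℂ (Matrix ι ι ℂ) := V.subtype ∘ₗ V.projectionOnto P hP
  have hp : lampl p x = x := by
    ext r s
    have : p (lslice r.2 s.2 x) = lslice r.2 s.2 x := by
      simpa [p] using congrArg Subtype.val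
        (Submodule.projectionOnto_apply_left hP ⟨_, hV r.2 s.2⟩)
    exact congrFun (congrFun this r.1) s.1
  rw [← hp, eq_sum_single_kronecker_rslice x]
  simp only [map_sum, lampl_kronecker]
  exact Submodule.sum_mem _ fun i _ => Submodule.sum_mem _ fun j _ =>
    Submodule.subset_span ⟨_, Subtype.property _, _, hW i j, rfl⟩

end Slices

section TensorProduct

variable [DecidableEq ι] [DecidableEq κ]
  {E₁ : Module.End ℂ (Matrix ι ι ℂ)} {E₂ : Module.End ℂ (Matrix κ κ ℂ)}
  {F : Module.End ℂ (Matrix (ι × κ) (ι × κ) ℂ)}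

lemma pow_apply_kronecker (hF : ∀ x y, F (x ⊗ₖ y) = E₁ x ⊗ₖ E₂ y) (n : ℕ)
    (x : Matrix ι ι ℂ) (y : Matrix κ κ ℂ) :
    (F ^ n) (x ⊗ₖ y) = (E₁ ^ n) x ⊗ₖ (E₂ ^ n) y := by
  induction n with
  | zero => rfl
  | succ n ih => simp only [pow_succ', Module.End.mul_apply, ih, hF]

lemma kronecker_mem_multDomain (hF : ∀ x y, F (x ⊗ₖ y) = E₁ x ⊗ₖ E₂ y)
    {a : Matrix ι ι ℂ} {b : Matrix κ κ ℂ} (ha : a ∈ multDomain E₁) (hb : b ∈ multDomain E₂) :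
    a ⊗ₖ b ∈ multDomain F := by
  refine kronecker_induction (fun x y hx hy => ?_) fun x y => ?_
  · simp [mul_add, add_mul, hx, hy]
  · simp [← Matrix.mul_kronecker_mul, hF, ha x, hb y]

/-- Elements of the multiplicative domain of a tensor product of channels are isometric. -/
lemma hsNormSq_eq_of_mem_multDomain (hF : ∀ x y, F (x ⊗ₖ y) = E₁ x ⊗ₖ E₂ y)
    (h₁ : IsQuantumChannel E₁) (h₂ : IsQuantumChannel E₂)
    {x : Matrix (ι × κ) (ι × κ) ℂ} (hx : x ∈ multDomain F) : hsNormSq (F x) = hsNormSq x := by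
  have hstar : ∀ y, F yᴴ = (F y)ᴴ := by
    refine kronecker_induction (fun x y hx hy => ?_) fun x y => ?_
    · simp [Matrix.conjTranspose_add, hx, hy]
    · simp [Matrix.conjTranspose_kronecker, hF, h₁.map_conjTranspose, h₂.map_conjTranspose]
  have htr : ∀ y, (F y).trace = y.trace := by
    refine kronecker_induction (fun x y hx hy => ?_) fun x y => ?_
    · simp [Matrix.trace_add, hx, hy]
    · simp [Matrix.trace_kronecker, hF, h₁.2, h₂.2]
  have := trace_conjTranspose_mul_self_eq_hsNormSq (F x)
  rw [← hstar, ← (hx xᴴ).2, htr, trace_conjTranspose_mul_self_eq_hsNormSq] at this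
  exact_mod_cast this.symm

lemma apply_eq_lampl_rampl (hF : ∀ x y, F (x ⊗ₖ y) = E₁ x ⊗ₖ E₂ y)
    (x : Matrix (ι × κ) (ι × κ) ℂ) : F x = lampl E₁ (rampl E₂ x) := by
  induction x using kronecker_induction with
  | hadd x y hx hy => simp [hx, hy]
  | hkr x y => rw [hF, rampl_kronecker, lampl_kronecker]

lemma apply_eq_rampl_lampl (hF : ∀ x y, F (x ⊗ₖ y) = E₁ x ⊗ₖ E₂ y)
    (x : Matrix (ι × κ) (ι × κ) ℂ) : F x = rampl E₂ (lampl E₁ x) := by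
  induction x using kronecker_induction with
  | hadd x y hx hy => simp [hx, hy]
  | hkr x y => rw [hF, lampl_kronecker, rampl_kronecker]

lemma hsNormSq_rampl_le (h : IsQuantumChannel E₂) (hu : E₂ 1 = 1)
    (x : Matrix (ι × κ) (ι × κ) ℂ) : hsNormSq (rampl E₂ x) ≤ hsNormSq x := by
  rw [hsNormSq_rampl, hsNormSq_eq_sum_rslice x]
  exact Finset.sum_le_sum fun i _ => Finset.sum_le_sum fun j _ => h.hsNormSq_le hu _

lemma hsNormSq_lampl_le (h : IsQuantumChannel E₁) (hu : E₁ 1 = 1)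
    (x : Matrix (ι × κ) (ι × κ) ℂ) : hsNormSq (lampl E₁ x) ≤ hsNormSq x := by
  rw [hsNormSq_lampl, hsNormSq_eq_sum_lslice x]
  exact Finset.sum_le_sum fun i _ => Finset.sum_le_sum fun j _ => h.hsNormSq_le hu _

lemma rslice_mem_multDomain (hF : ∀ x y, F (x ⊗ₖ y) = E₁ x ⊗ₖ E₂ y)
    (h₁ : IsQuantumChannel E₁) (hu₁ : E₁ 1 = 1) (h₂ : IsQuantumChannel E₂) (hu₂ : E₂ 1 = 1)
    {x : Matrix (ι × κ) (ι × κ) ℂ} (hx : x ∈ multDomain F) (i j : ι) :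
    rslice i j x ∈ multDomain E₂ := by
  have hle := hsNormSq_lampl_le h₁ hu₁ (rampl E₂ x)
  rw [← apply_eq_lampl_rampl hF, hsNormSq_eq_of_mem_multDomain hF h₁ h₂ hx, hsNormSq_rampl,
    hsNormSq_eq_sum_rslice x] at hle
  exact h₂.mem_multDomain_of_hsNormSq_eq hu₂
    (sum_sum_eq_imp (fun i j => h₂.hsNormSq_le hu₂ (rslice i j x)) hle i j)

lemma lslice_mem_multDomain (hF : ∀ x y, F (x ⊗ₖ y) = E₁ x ⊗ₖ E₂ y)
    (h₁ : IsQuantumChannel E₁) (hu₁ : E₁ 1 = 1) (h₂ : IsQuantumChannel E₂) (hu₂ : E₂ 1 = 1)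
    {x : Matrix (ι × κ) (ι × κ) ℂ} (hx : x ∈ multDomain F) (a b : κ) :
    lslice a b x ∈ multDomain E₁ := by
  have hle := hsNormSq_rampl_le h₂ hu₂ (lampl E₁ x)
  rw [← apply_eq_rampl_lampl hF, hsNormSq_eq_of_mem_multDomain hF h₁ h₂ hx, hsNormSq_lampl,
    hsNormSq_eq_sum_lslice x] at hle
  exact h₁.mem_multDomain_of_hsNormSq_eq hu₁
    (sum_sum_eq_imp (fun a b => h₁.hsNormSq_le hu₁ (lslice a b x)) hle a b)

end TensorProduct

/-- For unital quantum channels `E₁, E₂`, the stabilized multiplicative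
domain of their tensor product splits as the tensor product of the stabilized
multiplicative domains. -/
theorem stmt3 (d d' : ℕ)
    (E₁ : Module.End ℂ (Matrix (Fin d) (Fin d) ℂ))
    (E₂ : Module.End ℂ (Matrix (Fin d') (Fin d') ℂ))
    (h₁ : IsQuantumChannel E₁) (hu₁ : E₁ 1 = 1)
    (h₂ : IsQuantumChannel E₂) (hu₂ : E₂ 1 = 1)
    (F : Module.End ℂ (Matrix (Fin d × Fin d') (Fin d × Fin d') ℂ))
    (hF : ∀ (x : Matrix (Fin d) (Fin d) ℂ) (y : Matrix (Fin d') (Fin d') ℂ),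
      F (x ⊗ₖ y) = E₁ x ⊗ₖ E₂ y) :
    stabMultDomain F =
      SetLike.coe (Submodule.span ℂ
        {z | ∃ a ∈ stabMultDomain E₁, ∃ b ∈ stabMultDomain E₂, z = a ⊗ₖ b}) := by
  have hp := pow_apply_kronecker hF
  apply Set.Subset.antisymm
  · intro x hx
    simp only [← coe_stabMultDomainSubmodule E₁, ← coe_stabMultDomainSubmodule E₂]
    simp only [stabMultDomain, Set.mem_iInter] at hx
    refine mem_span_kronecker_of_slices (fun a b => ?_) fun i j => ?_
    · simp only [stabMultDomainSubmodule, Submodule.mem_iInf]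
      exact fun n hn => lslice_mem_multDomain (hp n) (isQuantumChannel_pow h₁ n)
        (pow_apply_one hu₁ n) (isQuantumChannel_pow h₂ n) (pow_apply_one hu₂ n) (hx n hn) a b
    · simp only [stabMultDomainSubmodule, Submodule.mem_iInf]
      exact fun n hn => rslice_mem_multDomain (hp n) (isQuantumChannel_pow h₁ n)
        (pow_apply_one hu₁ n) (isQuantumChannel_pow h₂ n) (pow_apply_one hu₂ n) (hx n hn) i j
  · rw [← coe_stabMultDomainSubmodule F, SetLike.coe_subset_coe, Submodule.span_le,
      coe_stabMultDomainSubmodule F]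
    rintro _ ⟨a, ha, b, hb, rfl⟩
    simp only [stabMultDomain, Set.mem_iInter] at ha hb ⊢
    exact fun n hn => kronecker_mem_multDomain (hp n) (ha n hn) (hb n hn)
end
end

section
/- Let B be a unital *-subalgebra of M_d given concretely as the block-diagonal algebra B = ⊕_{r=1}^m (M_{n_r} ⊗ 1_{k_r}) (so Σ_{r=1}^m n_r k_r = d). If A is a maximal unital proper *-subalgebra (MUPSA) of B, then there is a unitary u ∈ M_d such that u A u* has one of the following two forms: (1) u A u* = (M_{n_j−s} ⊗ 1_{k_j}) ⊕ (M_s ⊗ 1_{k_j}) ⊕ ⊕_{r≠j} (M_{n_r} ⊗ 1_{k_r}) for some index j ∈ {1,…,m} and some s with 1 ≤ s ≤ n_j − 1; or (2) u A u* = (M_{n_j} ⊗ 1_{k_j + k_i}) ⊕ ⊕_{r≠i,j} (M_{n_r} ⊗ 1_{k_r}) for some indices i ≠ j with n_i = n_j. -/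
noncomputable section

/-- The entry at position `(p, q)` of the block-diagonal matrix `⊕_r (a r ⊗ 1_{k r})`,
where the index set is `Σ r, Fin (n r) × Fin (k r)`. -/
def blockEntry {m : ℕ} {n k : Fin m → ℕ}
    (a : ∀ r, Matrix (Fin (n r)) (Fin (n r)) ℂ)
    (p q : Σ r : Fin m, Fin (n r) × Fin (k r)) : ℂ :=
  if h : p.1 = q.1 then
    if Fin.cast (congrArg k h) p.2.2 = q.2.2 then
      a q.1 (Fin.cast (congrArg n h) p.2.1) q.2.1
    else 0
  else 0

/-- The block-diagonal *-algebra `⊕_{r=1}^m (M_{n r} ⊗ 1_{k r})`, realized concretely as a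
set of matrices over the index set `Σ r, Fin (n r) × Fin (k r)`. -/
def blockAlgSet (m : ℕ) (n k : Fin m → ℕ) :
    Set (Matrix (Σ r : Fin m, Fin (n r) × Fin (k r))
         (Σ r : Fin m, Fin (n r) × Fin (k r)) ℂ) :=
  {x | ∃ a : ∀ r, Matrix (Fin (n r)) (Fin (n r)) ℂ, ∀ p q, x p q = blockEntry a p q}

/-- `A` is a maximal unital proper *-subalgebra (MUPSA) of `C`. -/
def IsMUPSAOf {B : Type*} [Semiring B] [StarRing B] [Algebra ℂ B] [StarModule ℂ B]
    (A C : StarSubalgebra ℂ B) : Prop :=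
  A ≤ C ∧ A ≠ C ∧ ∀ D : StarSubalgebra ℂ B, A ≤ D → D ≤ C → D = A ∨ D = C

/-- A star algebra of operators on a finite-dimensional space with scalar commutant contains every
operator. -/
theorem StarSubalgebra.eq_top_of_commutant_scalar {E : Type*} [NormedAddCommGroup E]
    [InnerProductSpace ℂ E] [FiniteDimensional ℂ E] (S : StarSubalgebra ℂ (E →L[ℂ] E))
    (hS : ∀ T : E →L[ℂ] E, (∀ s ∈ S, s * T = T * s) → ∃ c : ℂ, T = c • 1) : S = ⊤ := by
  let R := S.toSubalgebra
  have : IsScalarTower ℂ R E := ⟨fun _ _ _ => rfl⟩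
  have hss : IsSemisimpleModule R E := by
    refine (isSemisimpleModule_iff R E).2 ⟨fun W => ?_⟩
    let W₀ : Submodule ℂ E := W.restrictScalars ℂ
    let W' : Submodule R E :=
      { W₀ᗮ with
        smul_mem' := by
          intro r x hx
          change (r : E →L[ℂ] E) x ∈ W₀ᗮ
          rw [Submodule.mem_orthogonal]
          intro y hy
          rw [← ContinuousLinearMap.adjoint_inner_left]
          refine (Submodule.mem_orthogonal _ _).1 hx _ ?_
          exact W.smul_mem (⟨star (r : E →L[ℂ] E), S.star_mem' r.2⟩ : R) hy }
    refine ⟨W', ?_, ?_⟩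
    · rw [disjoint_iff, eq_bot_iff]
      intro x hx
      have : x ∈ W₀ ⊓ W₀ᗮ := ⟨hx.1, hx.2⟩
      rw [Submodule.inf_orthogonal_eq_bot] at this
      exact this
    · rw [codisjoint_iff, _root_.eq_top_iff]
      intro x _
      have : x ∈ W₀ ⊔ W₀ᗮ := by rw [Submodule.sup_orthogonal_of_hasOrthogonalProjection]; trivial
      obtain ⟨y, hy, z, hz, rfl⟩ := Submodule.mem_sup.1 this
      exact Submodule.add_mem_sup hy hz
  have hscalar : ∀ g : Module.End R E, ∃ c : ℂ, ∀ x, g x = c • x := by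
    intro g
    let g' : E →ₗ[ℂ] E := g.restrictScalars ℂ
    obtain ⟨c, hc⟩ := hS (LinearMap.toContinuousLinearMap g') (by
      intro s hs
      ext x
      exact (g.map_smul (⟨s, hs⟩ : R) x).symm)
    exact ⟨c, fun x => congrArg (fun T : E →L[ℂ] E => T x) hc⟩
  refine StarSubalgebra.eq_top_iff.2 fun f => ?_
  let F : Module.End (Module.End R E) E :=
    { toFun := f
      map_add' := f.map_add
      map_smul' := by
        intro g x
        obtain ⟨c, hc⟩ := hscalar g
        simp [hc] }
  classical
  let b := Module.finBasis ℂ E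
  obtain ⟨r, hr⟩ := jacobson_density F (Finset.univ.image b)
  have : f = (r : E →L[ℂ] E) := by
    apply ContinuousLinearMap.coe_injective
    refine b.ext fun i => ?_
    exact hr (b i) (by simp)
  rw [this]
  exact r.2

theorem StarSubalgebra.exists_isHermitian_commute_of_ne_top {n : ℕ}
    (S : StarSubalgebra ℂ (Matrix (Fin n) (Fin n) ℂ)) (hS : S ≠ ⊤) :
    ∃ h : Matrix (Fin n) (Fin n) ℂ, h.IsHermitian ∧ (∀ c : ℂ, h ≠ c • 1) ∧
      ∀ s ∈ S, s * h = h * s := by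
  by_contra! H
  apply hS
  let e := Matrix.toEuclideanCLM (n := Fin n) (𝕜 := ℂ)
  have key : ∀ T : Matrix (Fin n) (Fin n) ℂ, (∀ s ∈ S, s * T = T * s) → ∃ c : ℂ, T = c • 1 := by
    intro T hT
    have hT' : ∀ s ∈ S, s * star T = star T * s := by
      intro s hs
      have := congrArg star (hT (star s) (star_mem hs))
      simpa using this.symm
    have h1 : ∃ c : ℂ, T + star T = c • 1 := by
      by_contra! hc
      obtain ⟨s, hs, hne⟩ := H (T + star T) (IsSelfAdjoint.add_star_self T) hc
      exact hne (by rw [mul_add, add_mul, hT s hs, hT' s hs])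
    have h2 : ∃ c : ℂ, Complex.I • (T - star T) = c • 1 := by
      by_contra! hc
      obtain ⟨s, hs, hne⟩ := H (Complex.I • (T - star T)) (by
        change star _ = _
        simp [sub_eq_add_neg, add_comm]) hc
      exact hne (by rw [mul_smul_comm, smul_mul_assoc, mul_sub, sub_mul, hT s hs, hT' s hs])
    obtain ⟨c, hc⟩ := h1
    obtain ⟨d, hd⟩ := h2
    refine ⟨(1 / 2 : ℂ) * (c - Complex.I * d), ?_⟩
    rw [mul_smul, sub_smul, ← hc, mul_smul, ← hd, smul_smul, Complex.I_mul_I]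
    ext i j
    simp
    ring
  have htop : S.map (StarAlgEquiv.toStarAlgHom e) = ⊤ := by
    apply StarSubalgebra.eq_top_of_commutant_scalar
    intro T hT
    obtain ⟨c, hc⟩ := key (e.symm T) (by
      intro s hs
      apply (EquivLike.injective e)
      simpa using hT (e s) ⟨s, hs, rfl⟩)
    refine ⟨c, ?_⟩
    apply (EquivLike.injective e.symm)
    rw [hc]
    simp
  refine StarSubalgebra.eq_top_iff.2 fun x => ?_
  have hx : e x ∈ S.map (StarAlgEquiv.toStarAlgHom e) := by rw [htop]; trivial
  obtain ⟨y, hy, hyx⟩ := hx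
  rwa [← (EquivLike.injective e) hyx]

theorem StarSubalgebra.exists_unitary_reducing {n : ℕ}
    (S : StarSubalgebra ℂ (Matrix (Fin n) (Fin n) ℂ)) (hS : S ≠ ⊤) :
    ∃ u ∈ Matrix.unitaryGroup (Fin n) ℂ, ∃ t : ℕ, 0 < t ∧ t < n ∧ ∀ a ∈ S, ∀ i i' : Fin n,
      (((i : ℕ) < t ∧ ¬ (i' : ℕ) < t) ∨ (¬ (i : ℕ) < t ∧ (i' : ℕ) < t)) →
        (u * a * star u) i i' = 0 := by
  obtain ⟨h, hh, hns, hcomm⟩ := S.exists_isHermitian_commute_of_ne_top hS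
  let σ := Tuple.sort hh.eigenvalues
  let f := hh.eigenvalues ∘ σ
  have hf : Monotone f := Tuple.monotone_sort _
  have hne : ∃ t : Fin n, ∃ t₀ : Fin n, f t₀ < f t := by
    by_contra! H
    have hconst : ∃ c : ℝ, ∀ i, hh.eigenvalues i = c := by
      rcases isEmpty_or_nonempty (Fin n) with _ | ⟨⟨i₀⟩⟩
      · exact ⟨0, fun i => isEmptyElim i⟩
      · refine ⟨hh.eigenvalues i₀, fun i => ?_⟩
        have h1 := H (σ.symm i) (σ.symm i₀)
        have h2 := H (σ.symm i₀) (σ.symm i)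
        simp only [f, Function.comp, Equiv.apply_symm_apply] at h1 h2
        exact le_antisymm h1 h2
    obtain ⟨c, hc⟩ := hconst
    apply hns c
    have hsp := hh.spectral_theorem
    have hd : Matrix.diagonal ((RCLike.ofReal : ℝ → ℂ) ∘ hh.eigenvalues) = (c : ℂ) • 1 := by
      ext i j
      simp [Matrix.diagonal_apply, Matrix.one_apply, hc]
    rw [hd, map_smul, map_one] at hsp
    exact hsp
  obtain ⟨t₁, t₀, ht⟩ := hne
  let U : Matrix (Fin n) (Fin n) ℂ := hh.eigenvectorUnitary
  have hU1 : star U * U = 1 := Unitary.coe_star_mul_self hh.eigenvectorUnitary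
  have hU2 : U * star U = 1 := Unitary.coe_mul_star_self hh.eigenvectorUnitary
  have hsp : h = U * Matrix.diagonal ((RCLike.ofReal : ℝ → ℂ) ∘ hh.eigenvalues) * star U :=
    hh.spectral_theorem
  let u := (star U).submatrix σ id
  have hu : star u = U.submatrix id σ := by
    simp [u, Matrix.star_eq_conjTranspose, Matrix.conjTranspose_submatrix]
  let S' : Finset (Fin n) := Finset.univ.filter fun i => f t₀ < f i
  obtain ⟨t, htS, hmin⟩ := S'.exists_minimal ⟨t₁, by simp [S', ht]⟩
  have htS : f t₀ < f t := by simpa [S'] using htS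
  have hlt : ∀ i i' : Fin n, (i : ℕ) < t → ¬ (i' : ℕ) < t → f i < f i' := by
    intro i i' hi hi'
    have h1 : f t ≤ f i' := hf (by simpa using hi')
    have h2 : f i ≤ f t₀ := by
      by_contra! hlt
      have := hmin (y := i) (by simpa [S'] using hlt) (le_of_lt hi)
      exact absurd hi (not_lt.2 this)
    linarith
  refine ⟨u, ?_, t, ?_, t.2, ?_⟩
  · rw [Matrix.mem_unitaryGroup_iff, hu]
    simp only [u]
    rw [← Matrix.submatrix_mul _ _ _ _ _ Function.bijective_id, hU1]
    simp
  · have : t₀ < t := by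
      by_contra! hle
      exact absurd (hf hle) (not_le.2 htS)
    exact lt_of_le_of_lt (Nat.zero_le _) this
  · intro a ha i i' hii
    have hfne : f i ≠ f i' := by
      rcases hii with hii | hii
      · exact (hlt i i' hii.1 hii.2).ne
      · exact (hlt i' i hii.2 hii.1).ne'
    let D := Matrix.diagonal ((RCLike.ofReal : ℝ → ℂ) ∘ hh.eigenvalues)
    have hbD : (star U * a * U) * D = D * (star U * a * U) := by
      have hc := hcomm a ha
      rw [hsp] at hc
      calc (star U * a * U) * D
          = star U * (a * (U * D * star U)) * U := by
            simp only [mul_assoc, hU1, mul_one]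
        _ = star U * (U * D * star U * a) * U := by rw [hc]
        _ = (star U * U) * D * (star U * a * U) := by simp only [mul_assoc]
        _ = _ := by rw [hU1, one_mul]
    have hent := congrFun (congrFun hbD (σ i)) (σ i')
    simp only [D, Matrix.mul_diagonal, Matrix.diagonal_mul] at hent
    have huau : (u * a * star u) i i' = (star U * a * U) (σ i) (σ i') := by
      rw [hu]
      simp [u, Matrix.mul_apply]
    rw [huau]
    have : ((hh.eigenvalues (σ i) : ℂ) - (hh.eigenvalues (σ i') : ℂ)) *
        (star U * a * U) (σ i) (σ i') = 0 := by
      simp only [Function.comp] at hent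
      rw [sub_mul, sub_eq_zero]
      exact hent.symm.trans (mul_comm _ _)
    rcases mul_eq_zero.1 this with h0 | h0
    · exact absurd (Complex.ofReal_injective (sub_eq_zero.1 h0)) hfne
    · exact h0

theorem StarAlgEquiv.exists_unitary_matrix {a b : ℕ} (h : a = b)
    (θ : Matrix (Fin a) (Fin a) ℂ ≃⋆ₐ[ℂ] Matrix (Fin b) (Fin b) ℂ) :
    ∃ w ∈ Matrix.unitaryGroup (Fin b) ℂ, ∀ x,
      star w * θ x * w = x.submatrix (Fin.cast h.symm) (Fin.cast h.symm) := by
  subst h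
  let e := Matrix.toEuclideanCLM (n := Fin a) (𝕜 := ℂ)
  let f := (e.symm.trans θ).trans e
  obtain ⟨V, hV⟩ := f.eq_linearIsometryEquivConjStarAlgEquiv
    (f.toAlgEquiv.toLinearMap.continuous_of_finiteDimensional)
  let w := e.symm (V : EuclideanSpace ℂ (Fin a) →L[ℂ] EuclideanSpace ℂ (Fin a))
  have hw : star w * w = 1 := by
    apply (EquivLike.injective e)
    rw [map_mul, map_star, map_one]
    simp only [w, StarAlgEquiv.apply_symm_apply]
    ext1 x
    simp [ContinuousLinearMap.star_eq_adjoint]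
  refine ⟨w, Matrix.mem_unitaryGroup_iff'.2 hw, fun x => ?_⟩
  have hθ : θ x * w = w * x := by
    apply (EquivLike.injective e)
    have h1 := congrArg (fun g => g (e x)) hV
    simp only [f, StarAlgEquiv.trans_apply, StarAlgEquiv.symm_apply_apply] at h1
    rw [map_mul, map_mul, h1]
    simp only [w, StarAlgEquiv.apply_symm_apply]
    ext1 y
    simp
  rw [mul_assoc, hθ, ← mul_assoc, hw, one_mul]
  rfl

/-- The elements of `S` vanishing at `i` project onto a two-sided ideal of the simple ring `M j`;
if that ideal is nonzero then it contains `1`. -/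
theorem StarSubalgebra.exists_apply_eq_zero_apply_eq_one {ι : Type*} {M : ι → Type*}
    [∀ i, Ring (M i)] [∀ i, StarRing (M i)] [∀ i, Algebra ℂ (M i)] [∀ i, StarModule ℂ (M i)]
    [∀ i, IsSimpleRing (M i)] (S : StarSubalgebra ℂ (∀ i, M i))
    (hsurj : ∀ i (x : M i), ∃ a ∈ S, a i = x) {i j : ι}
    (hij : ∃ a ∈ S, a i = 0 ∧ a j ≠ 0) : ∃ a ∈ S, a i = 0 ∧ a j = 1 := by
  let I : TwoSidedIdeal (M j) := .mk' {x | ∃ a ∈ S, a i = 0 ∧ a j = x}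
    ⟨0, zero_mem S, rfl, rfl⟩
    (by
      rintro _ _ ⟨a, ha, ha0, rfl⟩ ⟨b, hb, hb0, rfl⟩
      exact ⟨a + b, add_mem ha hb, by simp [ha0, hb0], rfl⟩)
    (by
      rintro _ ⟨a, ha, ha0, rfl⟩
      exact ⟨-a, neg_mem ha, by simp [ha0], rfl⟩)
    (by
      rintro x _ ⟨a, ha, ha0, rfl⟩
      obtain ⟨b, hb, rfl⟩ := hsurj j x
      exact ⟨b * a, mul_mem hb ha, by simp [ha0], rfl⟩)
    (by
      rintro _ x ⟨a, ha, ha0, rfl⟩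
      obtain ⟨b, hb, rfl⟩ := hsurj j x
      exact ⟨a * b, mul_mem ha hb, by simp [ha0], rfl⟩)
  have hI : ∀ x, x ∈ I ↔ ∃ a ∈ S, a i = 0 ∧ a j = x := fun x => by
    simp only [I, TwoSidedIdeal.mem_mk', Set.mem_ofPred_eq]
  obtain ⟨a, ha, ha0, hane⟩ := hij
  rcases eq_bot_or_eq_top I with h | h
  · have : a j ∈ I := (hI _).2 ⟨a, ha, ha0, rfl⟩
    rw [h, TwoSidedIdeal.mem_bot] at this
    exact absurd this hane
  · exact (hI 1).1 (h ▸ trivial)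

theorem StarSubalgebra.eq_top_of_separating {ι : Type*} [Fintype ι] {M : ι → Type*}
    [∀ i, Ring (M i)] [∀ i, StarRing (M i)] [∀ i, Algebra ℂ (M i)] [∀ i, StarModule ℂ (M i)]
    [∀ i, IsSimpleRing (M i)] (S : StarSubalgebra ℂ (∀ i, M i))
    (hsurj : ∀ i (x : M i), ∃ a ∈ S, a i = x)
    (hsep : ∀ i j, i ≠ j → ∃ a ∈ S, a i = 0 ∧ a j ≠ 0) : S = ⊤ := by
  classical
  have hfin : ∀ (j : ι) (T : Finset ι), j ∉ T → ∃ a ∈ S, (∀ i ∈ T, a i = 0) ∧ a j = 1 := by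
    intro j T
    induction T using Finset.induction_on with
    | empty => exact fun _ => ⟨1, one_mem S, by simp, rfl⟩
    | insert i T _ ih =>
      intro hj
      rw [Finset.mem_insert, not_or] at hj
      obtain ⟨a, ha, haT, haj⟩ := ih hj.2
      obtain ⟨b, hb, hbi, hbj⟩ :=
        S.exists_apply_eq_zero_apply_eq_one hsurj (hsep i j (Ne.symm hj.1))
      refine ⟨a * b, mul_mem ha hb, ?_, by simp [haj, hbj]⟩
      intro l hl
      rcases Finset.mem_insert.1 hl with rfl | hl
      · simp [hbi]
      · simp [haT l hl]
  have hsingle : ∀ j (x : M j), Pi.single j x ∈ S := by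
    intro j x
    obtain ⟨a, ha, ha0, ha1⟩ := hfin j (Finset.univ.erase j) (by simp)
    obtain ⟨b, hb, rfl⟩ := hsurj j x
    convert mul_mem ha hb using 1
    ext l
    by_cases hl : l = j
    · subst hl
      simp [ha1]
    · simp [ha0 l (by simp [hl]), hl]
  refine StarSubalgebra.eq_top_iff.2 fun x => ?_
  rw [← Finset.univ_sum_single x]
  exact sum_mem fun j _ => hsingle j _

/-- A star homomorphism whose kernel contains that of a surjective one factors through it. -/
theorem StarAlgHom.exists_factor {R S T : Type*} [Ring R] [StarRing R] [Algebra ℂ R]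
    [Ring S] [StarRing S] [Algebra ℂ S] [Ring T] [StarRing T] [Algebra ℂ T]
    (f : R →⋆ₐ[ℂ] S) (g : R →⋆ₐ[ℂ] T) (hf : Function.Surjective f)
    (hfg : ∀ r, f r = 0 → g r = 0) : ∃ θ : S →⋆ₐ[ℂ] T, ∀ r, θ (f r) = g r := by
  have hker : ∀ r r', f r = f r' → g r = g r' := by
    intro r r' h
    rw [← sub_eq_zero, ← map_sub]
    exact hfg _ (by rw [map_sub, h, sub_self])
  have hs := Function.surjInv_eq hf
  have hθ : ∀ r x, f r = x → g (Function.surjInv hf x) = g r := fun r x h =>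
    hker _ _ ((hs x).trans h.symm)
  exact ⟨{  toFun := fun x => g (Function.surjInv hf x)
            map_one' := by rw [hθ 1 1 (map_one f), map_one]
            map_mul' := fun x y => by
              rw [← map_mul]; exact hθ _ _ (by rw [map_mul, hs, hs])
            map_zero' := by rw [hθ 0 0 (map_zero f), map_zero]
            map_add' := fun x y => by
              rw [← map_add]; exact hθ _ _ (by rw [map_add, hs, hs])
            commutes' := fun c => by
              rw [hθ (algebraMap ℂ R c) _ (AlgHomClass.commutes f c), AlgHomClass.commutes]
            map_star' := fun x => by
              rw [← map_star]; exact hθ _ _ (by rw [map_star, hs]) },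
    fun r => hθ r _ rfl⟩

/-- Every proper star subalgebra of a product of matrix algebras is, up to an inner automorphism,
either reducible in one factor or identifies two factors of the same size. -/
theorem StarSubalgebra.exists_reducing_or_linked {m : ℕ} {n : Fin m → ℕ} (hn : ∀ r, 0 < n r)
    (S : StarSubalgebra ℂ (∀ r, Matrix (Fin (n r)) (Fin (n r)) ℂ)) (hS : S ≠ ⊤) :
    ∃ v ∈ unitary (∀ r, Matrix (Fin (n r)) (Fin (n r)) ℂ),
      (∃ (j : Fin m) (t : ℕ), 0 < t ∧ t < n j ∧ ∀ a ∈ S, ∀ i i' : Fin (n j),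
        (((i : ℕ) < t ∧ ¬ (i' : ℕ) < t) ∨ (¬ (i : ℕ) < t ∧ (i' : ℕ) < t)) →
          (v * a * star v) j i i' = 0) ∨
      (∃ i j : Fin m, i ≠ j ∧ ∃ h : n i = n j, ∀ a ∈ S,
        (v * a * star v) i =
          ((v * a * star v) j).submatrix (Fin.cast h) (Fin.cast h)) := by
  have : ∀ r, Nonempty (Fin (n r)) := fun r => ⟨⟨0, hn r⟩⟩
  have hv : ∀ (j : Fin m) (u : Matrix (Fin (n j)) (Fin (n j)) ℂ),
      u ∈ Matrix.unitaryGroup (Fin (n j)) ℂ →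
      Function.update (1 : ∀ r, Matrix (Fin (n r)) (Fin (n r)) ℂ) j u ∈
        unitary (∀ r, Matrix (Fin (n r)) (Fin (n r)) ℂ) := by
    intro j u hu
    rw [Unitary.mem_iff]
    constructor <;> ext1 r <;> by_cases hr : r = j
    · subst hr
      simpa using Unitary.star_mul_self_of_mem hu
    · simp [hr]
    · subst hr
      simpa using Unitary.mul_star_self_of_mem hu
    · simp [hr]
  let π (r : Fin m) : (∀ r, Matrix (Fin (n r)) (Fin (n r)) ℂ) →⋆ₐ[ℂ]
      Matrix (Fin (n r)) (Fin (n r)) ℂ := { Pi.evalAlgHom ℂ _ r with map_star' := fun _ => rfl }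
  by_cases hsurj : ∀ r, S.map (π r) = ⊤
  · have hsurj' : ∀ r (x : Matrix (Fin (n r)) (Fin (n r)) ℂ), ∃ a ∈ S, a r = x := by
      intro r x
      have hx : x ∈ S.map (π r) := by rw [hsurj r]; trivial
      exact hx
    have hlink : ∃ i j, i ≠ j ∧ ∀ a ∈ S, a i = 0 → a j = 0 := by
      by_contra! H
      exact hS (S.eq_top_of_separating hsurj' H)
    obtain ⟨i, j, hij, hker⟩ := hlink
    obtain ⟨θ, hθ⟩ := StarAlgHom.exists_factor ((π i).comp S.subtype) ((π j).comp S.subtype)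
      (fun x => by
        obtain ⟨a, ha, hax⟩ := hsurj' i x
        exact ⟨⟨a, ha⟩, hax⟩)
      (fun a => hker a a.2)
    have hbij : Function.Bijective θ := by
      constructor
      · let θ' : Matrix (Fin (n i)) (Fin (n i)) ℂ →+* Matrix (Fin (n j)) (Fin (n j)) ℂ :=
          θ.toAlgHom.toRingHom
        exact θ'.injective
      · intro y
        obtain ⟨a, ha, hay⟩ := hsurj' j y
        exact ⟨a i, (hθ ⟨a, ha⟩).trans hay⟩
    let Θ := StarAlgEquiv.ofBijective θ hbij
    have hsize : n i = n j := by
      have := LinearEquiv.finrank_eq Θ.toAlgEquiv.toLinearEquiv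
      simp only [Module.finrank_matrix, Fintype.card_fin, Module.finrank_self, mul_one] at this
      exact Nat.mul_self_inj.1 this
    obtain ⟨w, hw, hwθ⟩ := Θ.exists_unitary_matrix hsize
    refine ⟨_, hv j (star w) (Unitary.star_mem hw), Or.inr ⟨i, j, hij, hsize, fun a ha => ?_⟩⟩
    have h1 : Θ (a i) = a j := hθ ⟨a, ha⟩
    have h2 := hwθ (a i)
    rw [h1] at h2
    simp only [Pi.mul_apply, Pi.star_apply, Function.update_self, star_star, h2,
      Function.update_of_ne hij]
    ext
    simp
  · push Not at hsurj
    obtain ⟨j, hj⟩ := hsurj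
    obtain ⟨u, hu, t, ht, htn, H⟩ := (S.map (π j)).exists_unitary_reducing hj
    refine ⟨_, hv j u hu, Or.inl ⟨j, t, ht, htn, fun a ha i i' hii => ?_⟩⟩
    simpa using H (a j) ⟨a, ha, rfl⟩ i i' hii

/-- Elements of a product of matrix algebras that are block diagonal, with cut at `t`, in the
factor `j`. -/
def cutSubalgebra {m : ℕ} (n : Fin m → ℕ) (j : Fin m) (t : ℕ) :
    StarSubalgebra ℂ (∀ r, Matrix (Fin (n r)) (Fin (n r)) ℂ) where
  carrier := {a | ∀ i i' : Fin (n j),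
    (((i : ℕ) < t ∧ ¬ (i' : ℕ) < t) ∨ (¬ (i : ℕ) < t ∧ (i' : ℕ) < t)) → a j i i' = 0}
  mul_mem' := by
    intro a b ha hb i i' h
    rw [Pi.mul_apply, Matrix.mul_apply]
    refine Finset.sum_eq_zero fun l _ => ?_
    by_cases hl : ((i : ℕ) < t ∧ ¬ (l : ℕ) < t) ∨ (¬ (i : ℕ) < t ∧ (l : ℕ) < t)
    · rw [ha i l hl, zero_mul]
    · rw [hb l i' (by tauto), mul_zero]
  add_mem' := by
    intro a b ha hb i i' h
    simp [ha i i' h, hb i i' h]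
  algebraMap_mem' := by
    intro c i i' h
    have : i ≠ i' := by rintro rfl; tauto
    simp [Matrix.algebraMap_matrix_apply, this]
  star_mem' := by
    intro a ha i i' h
    simp [Matrix.star_apply, ha i' i (by tauto)]

/-- Elements of a product of matrix algebras whose factors `i` and `j` agree. -/
def linkSubalgebra {m : ℕ} (n : Fin m → ℕ) (i j : Fin m) (h : n i = n j) :
    StarSubalgebra ℂ (∀ r, Matrix (Fin (n r)) (Fin (n r)) ℂ) where
  carrier := {a | ∀ ii jj : Fin (n i), a i ii jj = a j (Fin.cast h ii) (Fin.cast h jj)}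
  mul_mem' := by
    intro a b ha hb ii jj
    simp only [Pi.mul_apply, Matrix.mul_apply, ha ii, hb _ jj]
    exact (finCongr h).sum_comp (fun l => a j (Fin.cast h ii) l * b j l (Fin.cast h jj))
  add_mem' := by
    intro a b ha hb ii jj
    simp [ha ii jj, hb ii jj]
  algebraMap_mem' := by
    intro c ii jj
    simp [Matrix.algebraMap_matrix_apply]
  star_mem' := by
    intro a ha ii jj
    simp [Matrix.star_apply, ha jj ii]

theorem cutSubalgebra_ne_top {m : ℕ} {n : Fin m → ℕ} {j : Fin m} {t : ℕ} (ht : 0 < t)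
    (htn : t < n j) : cutSubalgebra n j t ≠ ⊤ := by
  intro h
  have h1 : (fun _ _ _ => 1 : ∀ r, Matrix (Fin (n r)) (Fin (n r)) ℂ) ∈ cutSubalgebra n j t := by
    rw [h]; trivial
  exact one_ne_zero (h1 ⟨0, ht.trans htn⟩ ⟨t, htn⟩ (by simp [ht]))

theorem linkSubalgebra_ne_top {m : ℕ} {n : Fin m → ℕ} {i j : Fin m} (hij : i ≠ j)
    (hn : 0 < n i) (h : n i = n j) : linkSubalgebra n i j h ≠ ⊤ := by
  intro htop
  have h1 : (Pi.single i 1 : ∀ r, Matrix (Fin (n r)) (Fin (n r)) ℂ) ∈ linkSubalgebra n i j h := by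
    rw [htop]; trivial
  have := h1 ⟨0, hn⟩ ⟨0, hn⟩
  simp [hij.symm] at this

theorem blockEntry_eq_blockDiagonal' {m : ℕ} {n k : Fin m → ℕ}
    (a : ∀ r, Matrix (Fin (n r)) (Fin (n r)) ℂ) :
    Matrix.of (blockEntry (k := k) a) = Matrix.blockDiagonal' fun r =>
      Matrix.kronecker (a r) (1 : Matrix (Fin (k r)) (Fin (k r)) ℂ) := by
  ext ⟨r, i, x⟩ ⟨r', i', x'⟩
  by_cases h : r = r'
  · subst h
    simp [blockEntry, Matrix.blockDiagonal'_apply, Matrix.one_apply]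
  · simp [blockEntry, Matrix.blockDiagonal'_apply, h]

/-- The block-diagonal embedding `a ↦ ⊕_r (a r ⊗ 1)`. -/
def blockHom {m : ℕ} (n k : Fin m → ℕ) :
    (∀ r, Matrix (Fin (n r)) (Fin (n r)) ℂ) →⋆ₐ[ℂ]
      Matrix (Σ r : Fin m, Fin (n r) × Fin (k r)) (Σ r : Fin m, Fin (n r) × Fin (k r)) ℂ where
  toFun a := Matrix.of (blockEntry a)
  map_one' := by
    rw [blockEntry_eq_blockDiagonal', ← Matrix.blockDiagonal'_one]
    congr 1; ext1 r
    exact Matrix.one_kronecker_one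
  map_zero' := by
    rw [blockEntry_eq_blockDiagonal', ← Matrix.blockDiagonal'_zero]
    congr 1; ext1 r
    exact Matrix.zero_kronecker _
  map_mul' a b := by
    simp only [blockEntry_eq_blockDiagonal', ← Matrix.blockDiagonal'_mul]
    congr 1; ext1 r
    simpa using Matrix.mul_kronecker_mul (a r) (b r) (1 : Matrix (Fin (k r)) (Fin (k r)) ℂ) 1
  map_add' a b := by
    simp only [blockEntry_eq_blockDiagonal', ← Matrix.blockDiagonal'_add]
    congr 1; ext1 r
    exact Matrix.add_kronecker _ _ _
  commutes' c := by
    rw [blockEntry_eq_blockDiagonal', Algebra.algebraMap_eq_smul_one, Algebra.algebraMap_eq_smul_one,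
      ← Matrix.blockDiagonal'_one, ← Matrix.blockDiagonal'_smul]
    congr 1; ext1 r
    exact (Matrix.smul_kronecker c 1 1).trans (congrArg _ Matrix.one_kronecker_one)
  map_star' a := by
    simp only [blockEntry_eq_blockDiagonal', Matrix.star_eq_conjTranspose,
      Matrix.blockDiagonal'_conjTranspose]
    congr 1; ext1 r
    simpa [Matrix.star_eq_conjTranspose] using
      (Matrix.conjTranspose_kronecker (a r) (1 : Matrix (Fin (k r)) (Fin (k r)) ℂ)).symm

theorem blockHom_injective {m : ℕ} {n k : Fin m → ℕ} (hk : ∀ r, 0 < k r) :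
    Function.Injective (blockHom n k) := by
  intro a b hab
  ext r i i'
  have := congrFun (congrFun hab ⟨r, i, ⟨0, hk r⟩⟩) ⟨r, i', ⟨0, hk r⟩⟩
  simpa [blockHom, blockEntry] using this

/-- If `A` is a MUPSA of the concrete block-diagonal algebra
`B = ⊕_{r=1}^m (M_{n r} ⊗ 1_{k r})`, then, after conjugating by a suitable unitary `u`,
`A` either (1) refines one diagonal block `M_{n j} ⊗ 1_{k j}` into
`(M_{n j - s} ⊗ 1_{k j}) ⊕ (M_s ⊗ 1_{k j})`, or (2) merges two blocks with `n i = n j`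
into `M_{n j} ⊗ 1_{k j + k i}`, leaving all other blocks unchanged. -/
theorem stmt10 (m : ℕ) (n k : Fin m → ℕ) (hn : ∀ r, 0 < n r) (hk : ∀ r, 0 < k r)
    (B A : StarSubalgebra ℂ (Matrix (Σ r : Fin m, Fin (n r) × Fin (k r))
      (Σ r : Fin m, Fin (n r) × Fin (k r)) ℂ))
    (hB : (B : Set _) = blockAlgSet m n k)
    (hA : IsMUPSAOf A B) :
    ∃ u ∈ Matrix.unitaryGroup (Σ r : Fin m, Fin (n r) × Fin (k r)) ℂ,
      (∃ (j : Fin m) (s : ℕ), 1 ≤ s ∧ s ≤ n j - 1 ∧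
        (fun x => u * x * star u) '' (A : Set _) =
          {x | ∃ a : ∀ r, Matrix (Fin (n r)) (Fin (n r)) ℂ,
            (∀ p q, x p q = blockEntry a p q) ∧
            ∀ i i' : Fin (n j),
              (((i : ℕ) < n j - s ∧ ¬ (i' : ℕ) < n j - s) ∨
               (¬ (i : ℕ) < n j - s ∧ (i' : ℕ) < n j - s)) → a j i i' = 0}) ∨
      (∃ i j : Fin m, i ≠ j ∧ ∃ h : n i = n j,
        (fun x => u * x * star u) '' (A : Set _) =
          {x | ∃ a : ∀ r, Matrix (Fin (n r)) (Fin (n r)) ℂ,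
            (∀ p q, x p q = blockEntry a p q) ∧
            ∀ ii jj : Fin (n i),
              a i ii jj = a j (Fin.cast h ii) (Fin.cast h jj)}) := by
  let φ := blockHom n k
  have hφ : Function.Injective φ := blockHom_injective hk
  have hBφ : ∀ x, x ∈ B ↔ ∃ a, φ a = x := by
    intro x
    rw [← SetLike.mem_coe, hB]
    exact exists_congr fun a => ⟨fun h => by ext p q; exact (h p q).symm, fun h p q => by
      rw [← h]; rfl⟩
  obtain ⟨hAB, hne, hmax⟩ := hA
  let S := A.comap φ
  have hS : S ≠ ⊤ := by
    intro h
    refine hne (le_antisymm hAB fun x hx => ?_)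
    obtain ⟨a, rfl⟩ := (hBφ x).1 hx
    have : a ∈ S := by rw [h]; trivial
    exact this
  have hSmax : ∀ V : StarSubalgebra ℂ (∀ r, Matrix (Fin (n r)) (Fin (n r)) ℂ),
      V ≠ ⊤ → ∀ v ∈ unitary (∀ r, Matrix (Fin (n r)) (Fin (n r)) ℂ),
      (∀ a ∈ S, v * a * star v ∈ V) →
      (fun x => φ v * x * star (φ v)) '' (A : Set _) =
        {x | ∃ a, (∀ p q, x p q = blockEntry a p q) ∧ a ∈ V} := by
    intro V hV v hv hSV
    let c := Unitary.conjStarAlgAut ℂ (∀ r, Matrix (Fin (n r)) (Fin (n r)) ℂ) ⟨v, hv⟩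
    let D := V.comap (StarAlgEquiv.toStarAlgHom c)
    have hDtop : D ≠ ⊤ := by
      intro h
      refine hV (StarSubalgebra.eq_top_iff.2 fun x => ?_)
      have hx : c.symm x ∈ D := by rw [h]; trivial
      have : c (c.symm x) ∈ V := hx
      simpa using this
    have hDA : D.map φ = A := by
      refine (hmax (D.map φ) ?_ ?_).resolve_right ?_
      · intro x hx
        obtain ⟨a, rfl⟩ := (hBφ x).1 (hAB hx)
        exact ⟨a, hSV a hx, rfl⟩
      · rintro _ ⟨a, -, rfl⟩
        exact (hBφ _).2 ⟨a, rfl⟩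
      · intro h
        refine hDtop (StarSubalgebra.eq_top_iff.2 fun a => ?_)
        have ha : φ a ∈ D.map φ := by rw [h]; exact (hBφ _).2 ⟨a, rfl⟩
        obtain ⟨b, hb, hba⟩ := ha
        rwa [← hφ hba]
    ext x
    constructor
    · rintro ⟨y, hy, rfl⟩
      rw [SetLike.mem_coe, ← hDA] at hy
      obtain ⟨a, ha, rfl⟩ := hy
      refine ⟨v * a * star v, fun p q => ?_, ha⟩
      change (φ v * φ a * star (φ v)) p q = φ (v * a * star v) p q
      rw [map_mul, map_mul, map_star]
    · rintro ⟨a, hax, haV⟩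
      have hx : x = φ a := by ext p q; exact hax p q
      have hca : c (c.symm a) = a := c.apply_symm_apply a
      refine ⟨φ (c.symm a), ?_, ?_⟩
      · rw [SetLike.mem_coe, ← hDA]
        refine ⟨c.symm a, ?_, rfl⟩
        change c (c.symm a) ∈ V
        rwa [hca]
      · change φ v * φ (c.symm a) * star (φ v) = x
        rw [hx, ← map_star, ← map_mul, ← map_mul]
        exact congrArg φ hca
  obtain ⟨v, hv, h⟩ := S.exists_reducing_or_linked hn hS
  refine ⟨φ v, ?_, ?_⟩
  · rw [Matrix.mem_unitaryGroup_iff, ← map_star, ← map_mul, Unitary.mul_star_self_of_mem hv,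
      map_one]
  · rcases h with ⟨j, t, ht, htn, H⟩ | ⟨i, j, hij, h, H⟩
    · refine Or.inl ⟨j, n j - t, by omega, by omega, ?_⟩
      rw [Nat.sub_sub_self htn.le]
      exact hSmax (cutSubalgebra n j t) (cutSubalgebra_ne_top ht htn) v hv H
    · refine Or.inr ⟨i, j, hij, h, ?_⟩
      exact hSmax (linkSubalgebra n i j h) (linkSubalgebra_ne_top hij (hn i) h) v hv
        fun a ha ii jj => congrFun (congrFun (H a ha) ii) jj
end
end
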